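/- arXiv:2302.04402 — 2 statements merged into one kernel-verified Lean document; each statement's English description precedes it below -/
import Mathlib

section
/- Let B_𝒥 be a non-degenerate Grothendieck Boolean algebra and let Y, Z be B_𝒥-sets. Then the B-set Z^Y of B-set homomorphisms Y → Z under the pointwise operations b(f,g)(y) = b(f(y), g(y)) is itself a B_𝒥-set: for every P ∈ 𝒥 and every family of B-set homomorphisms (f_b : Y → Z)_{b ∈ P}, there is a unique B-set homomorphism g : Y → Z with g(y) ≡_b f_b(y) for all b ∈ P and y ∈ Y. Consequently the evaluation map and transposes of homomorphisms X × Y → Z make Z^Y an exponential, so the category of B_𝒥-sets is cartesian closed. -/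
/-- A `B`-set structure on `X`, for a Boolean algebra `B`. -/
structure BSetStruct (B : Type) [BooleanAlgebra B] (X : Type) where
  act : B → X → X → X
  act_refl : ∀ b x, act b x x = x
  act_absorb_left : ∀ b x y z, act b (act b x y) z = act b x z
  act_absorb_right : ∀ b x y z, act b x (act b y z) = act b x z
  act_top : ∀ x y, act ⊤ x y = x
  act_compl : ∀ b x y, act bᶜ x y = act b y x
  act_inf : ∀ b c x y, act (b ⊓ c) x y = act b (act c x y) y

/-- The relation `x ≡_b y`, i.e. `b(x,y) = y`. -/
def BSetStruct.eqv {B X : Type} [BooleanAlgebra B] (S : BSetStruct B X)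
    (b : B) (x y : X) : Prop :=
  S.act b x y = y

/-- A homomorphism of `B`-sets. -/
def IsBSetHom {B X Y : Type} [BooleanAlgebra B]
    (SX : BSetStruct B X) (SY : BSetStruct B Y) (f : X → Y) : Prop :=
  ∀ b x y, f (SX.act b x y) = SY.act b (f x) (f y)

/-- `P` is a partition of `b`: a set of nonzero pairwise-disjoint elements
whose supremum exists and equals `b`. -/
def IsPartitionOf {B : Type} [BooleanAlgebra B] (P : Set B) (b : B) : Prop :=
  (∀ c ∈ P, c ≠ ⊥) ∧ (∀ c ∈ P, ∀ d ∈ P, c ≠ d → c ⊓ d = ⊥) ∧ IsLUB P b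

/-- A zero-dimensional topology on a Boolean algebra `B`: a collection `J` of
partitions of `1` containing all finite partitions, closed under refinement and
under images along surjections. -/
structure ZeroDimTopology (B : Type) [BooleanAlgebra B] where
  J : Set (Set B)
  partitions : ∀ P ∈ J, IsPartitionOf P ⊤
  finite_mem : ∀ P : Set B, IsPartitionOf P ⊤ → P.Finite → P ∈ J
  refine : ∀ P ∈ J, ∀ Q : B → Set B, (∀ b ∈ P, Q b ∈ J) →
      ({d : B | ∃ b ∈ P, ∃ c ∈ Q b, d = b ⊓ c} \ {⊥}) ∈ J
  glue : ∀ (P : Set B), P ∈ J → ∀ (I : Type) (α : P → I), Function.Surjective α →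
      (∀ i : I, ∃ s : B, IsLUB (Subtype.val '' (α ⁻¹' {i})) s) ∧
      {s : B | ∃ i : I, IsLUB (Subtype.val '' (α ⁻¹' {i})) s} ∈ J

/-- A `B_𝒥`-set: a `B`-set together with an operation `X^P → X` for each
infinite partition `P ∈ 𝒥`, satisfying the three axioms. -/
structure BJSetStruct (B : Type) [BooleanAlgebra B] (𝒥 : ZeroDimTopology B)
    (X : Type) extends BSetStruct B X where
  pop : ∀ (P : Set B), P ∈ 𝒥.J → P.Infinite → (P → X) → X
  pop_const : ∀ (P : Set B) (hP : P ∈ 𝒥.J) (hinf : P.Infinite) (x : X),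
      pop P hP hinf (fun _ => x) = x
  pop_act : ∀ (P : Set B) (hP : P ∈ 𝒥.J) (hinf : P.Infinite) (x y : P → X),
      pop P hP hinf (fun b => act b.1 (x b) (y b)) = pop P hP hinf x
  act_pop : ∀ (P : Set B) (hP : P ∈ 𝒥.J) (hinf : P.Infinite) (x : P → X) (b : P),
      act b.1 (pop P hP hinf x) (x b) = x b

/-- The product of two `B`-sets, with componentwise operations. -/
def prodBSet {B X Y : Type} [BooleanAlgebra B]
    (SX : BSetStruct B X) (SY : BSetStruct B Y) : BSetStruct B (X × Y) where
  act b p q := (SX.act b p.1 q.1, SY.act b p.2 q.2)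
  act_refl b x := by simp [SX.act_refl, SY.act_refl]
  act_absorb_left b x y z := by simp [SX.act_absorb_left, SY.act_absorb_left]
  act_absorb_right b x y z := by simp [SX.act_absorb_right, SY.act_absorb_right]
  act_top x y := by simp [SX.act_top, SY.act_top]
  act_compl b x y := by simp [SX.act_compl, SY.act_compl]
  act_inf b c x y := by simp [SX.act_inf, SY.act_inf]

namespace BSetStruct

variable {B X : Type} [BooleanAlgebra B] (S : BSetStruct B X)

variable {S} in
theorem eqv.symm {b : B} {x y : X} (h : S.eqv b x y) : S.eqv b y x := by
  unfold eqv at *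
  rw [← h, S.act_absorb_left, S.act_refl]

variable {S} in
theorem eqv.trans {b : B} {x y z : X} (h : S.eqv b x y) (h' : S.eqv b y z) :
    S.eqv b x z := by
  unfold eqv at *
  rwa [← h, S.act_absorb_left] at h'

variable {S} in
theorem eqv.mono {b c : B} {x y : X} (h : S.eqv b x y) (hcb : c ≤ b) : S.eqv c x y := by
  unfold eqv at *
  rw [← inf_eq_left.mpr hcb, S.act_inf, h, S.act_refl]

theorem eqv_bot (x y : X) : S.eqv ⊥ x y := by
  unfold eqv
  rw [← compl_top, S.act_compl, S.act_top]

variable {S} in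
theorem eqv.sup {b c : B} {x y : X} (h : S.eqv b x y) (h' : S.eqv c x y) :
    S.eqv (b ⊔ c) x y := by
  unfold eqv at *
  rw [← compl_compl (b ⊔ c), compl_sup, S.act_compl, S.act_inf, S.act_compl,
    S.act_compl, h', h]

theorem eq_of_eqv_top {x y : X} (h : S.eqv ⊤ x y) : x = y := by
  rwa [eqv, S.act_top] at h

theorem act_eqv_left (b : B) (x y : X) : S.eqv b (S.act b x y) x := by
  rw [eqv, S.act_absorb_left, S.act_refl]

theorem act_eqv_right (b : B) (x y : X) : S.eqv bᶜ (S.act b x y) y := by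
  rw [eqv, S.act_compl, S.act_absorb_right, S.act_refl]

variable {S} in
theorem eqv.of_inf {b c : B} {x y : X} (h : S.eqv (c ⊓ b) x y) (h' : S.eqv (c ⊓ bᶜ) x y) :
    S.eqv c x y := by
  simpa [← inf_sup_left] using h.sup h'

variable {S} in
theorem eqv.act {c : B} {x x' y y' : X} (hx : S.eqv c x x') (hy : S.eqv c y y') (b : B) :
    S.eqv c (S.act b x y) (S.act b x' y') :=
  eqv.of_inf (b := b)
    ((((S.act_eqv_left b x y).mono inf_le_right).trans (hx.mono inf_le_left)).trans
      ((S.act_eqv_left b x' y').mono inf_le_right).symm)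
    ((((S.act_eqv_right b x y).mono inf_le_right).trans (hy.mono inf_le_left)).trans
      ((S.act_eqv_right b x' y').mono inf_le_right).symm)

theorem act_act_act_comm (b c : B) (x y z w : X) :
    S.act b (S.act c x y) (S.act c z w) = S.act c (S.act b x z) (S.act b y w) := by
  apply S.eq_of_eqv_top
  refine eqv.of_inf (b := b) ?_ ?_ <;> rw [top_inf_eq]
  · exact (S.act_eqv_left _ _ _).trans
      ((S.act_eqv_left b x z).act (S.act_eqv_left b y w) c).symm
  · exact (S.act_eqv_right _ _ _).trans
      ((S.act_eqv_right b x z).act (S.act_eqv_right b y w) c).symm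

theorem eqv_finset_sup (s : Finset B) {x y : X} (h : ∀ b ∈ s, S.eqv b x y) :
    S.eqv (s.sup id) x y := by
  classical
  induction s using Finset.induction_on with
  | empty => exact S.eqv_bot x y
  | insert a s _ ih =>
    rw [Finset.sup_insert]
    exact (h a (Finset.mem_insert_self a s)).sup
      (ih fun b hb => h b (Finset.mem_insert_of_mem hb))

theorem exists_eqv_of_finset [Nonempty X] (s : Finset B)
    (hs : ∀ c ∈ s, ∀ d ∈ s, c ≠ d → c ⊓ d = ⊥) (f : B → X) :
    ∃ x, ∀ b ∈ s, S.eqv b x (f b) := by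
  classical
  induction s using Finset.induction_on with
  | empty => exact ⟨Classical.arbitrary X, by simp⟩
  | insert a s ha ih =>
    obtain ⟨x, hx⟩ := ih fun c hc d hd =>
      hs c (Finset.mem_insert_of_mem hc) d (Finset.mem_insert_of_mem hd)
    refine ⟨S.act a (f a) x, fun b hb => ?_⟩
    rcases Finset.mem_insert.mp hb with rfl | hbs
    · exact S.act_eqv_left _ _ _
    · have hba : b ≤ aᶜ := by
        rw [le_compl_iff_disjoint_right, disjoint_iff]
        exact hs b hb a (Finset.mem_insert_self a s) (by rintro rfl; exact ha hbs)
      exact ((S.act_eqv_right a (f a) x).mono hba).trans (hx b hbs)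

/-- The pointwise `B`-set of homomorphisms. -/
def hom {Y : Type} (SY : BSetStruct B Y) (S : BSetStruct B X) :
    BSetStruct B {f : Y → X // IsBSetHom SY S f} where
  act b f g := ⟨fun y => S.act b (f.1 y) (g.1 y), fun c y z => by
    simp only [f.2 c y z, g.2 c y z, S.act_act_act_comm]⟩
  act_refl b f := Subtype.ext (funext fun y => S.act_refl _ _)
  act_absorb_left b f g h := Subtype.ext (funext fun y => S.act_absorb_left _ _ _ _)
  act_absorb_right b f g h := Subtype.ext (funext fun y => S.act_absorb_right _ _ _ _)
  act_top f g := Subtype.ext (funext fun y => S.act_top _ _)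
  act_compl b f g := Subtype.ext (funext fun y => S.act_compl _ _ _)
  act_inf b c f g := Subtype.ext (funext fun y => S.act_inf _ _ _ _)

end BSetStruct

namespace BJSetStruct

variable {B X Y : Type} [BooleanAlgebra B] {𝒥 : ZeroDimTopology B}

theorem eq_of_forall_eqv (S : BJSetStruct B 𝒥 X) {P : Set B} (hP : P ∈ 𝒥.J) {x y : X}
    (h : ∀ b ∈ P, S.eqv b x y) : x = y := by
  rcases P.finite_or_infinite with hfin | hinf
  · have hsup : hfin.toFinset.sup id = ⊤ :=
      top_le_iff.mp ((𝒥.partitions P hP).2.2.2 fun b hb =>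
        Finset.le_sup (f := id) (hfin.mem_toFinset.mpr hb))
    apply S.eq_of_eqv_top
    rw [← hsup]
    exact S.eqv_finset_sup _ fun b hb => h b (hfin.mem_toFinset.mp hb)
  · have hxy : (fun b : P => S.act b.1 x y) = fun _ => y := funext fun b => h b.1 b.2
    rw [← S.pop_const P hP hinf x, ← S.pop_act P hP hinf (fun _ => x) (fun _ => y), hxy,
      S.pop_const]

theorem exists_eqv (nondeg : (⊥ : B) ≠ ⊤) (S : BJSetStruct B 𝒥 X) {P : Set B}
    (hP : P ∈ 𝒥.J) (f : P → X) : ∃ x, ∀ b : P, S.eqv b.1 x (f b) := by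
  classical
  rcases P.finite_or_infinite with hfin | hinf
  · obtain ⟨-, hdisj, hlub⟩ := 𝒥.partitions P hP
    obtain ⟨a, ha⟩ : P.Nonempty := by
      rw [Set.nonempty_iff_ne_empty]
      rintro rfl
      exact nondeg (isLUB_empty.unique hlub)
    have : Nonempty X := ⟨f ⟨a, ha⟩⟩
    obtain ⟨x, hx⟩ := S.exists_eqv_of_finset hfin.toFinset
      (fun c hc d hd => hdisj c (hfin.mem_toFinset.mp hc) d (hfin.mem_toFinset.mp hd))
      (fun b => if hb : b ∈ P then f ⟨b, hb⟩ else f ⟨a, ha⟩)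
    refine ⟨x, fun b => ?_⟩
    simpa using hx b.1 (hfin.mem_toFinset.mpr b.2)
  · exact ⟨S.pop P hP hinf f, S.act_pop P hP hinf f⟩

theorem isBSetHom_of_eqv {SY : BSetStruct B Y} (S : BJSetStruct B 𝒥 X) {P : Set B}
    (hP : P ∈ 𝒥.J) {f : P → Y → X} (hf : ∀ b, IsBSetHom SY S.toBSetStruct (f b))
    {g : Y → X} (hg : ∀ (b : P) (y : Y), S.eqv b.1 (g y) (f b y)) :
    IsBSetHom SY S.toBSetStruct g := by
  intro c y z
  refine S.eq_of_forall_eqv hP fun b hb => ?_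
  have h := hg ⟨b, hb⟩ (SY.act c y z)
  rw [hf] at h
  exact h.trans ((hg ⟨b, hb⟩ y).act (hg ⟨b, hb⟩ z) c).symm

/-- The pointwise `B_𝒥`-set of homomorphisms. -/
def hom (SY : BSetStruct B Y) (S : BJSetStruct B 𝒥 X) :
    BJSetStruct B 𝒥 {f : Y → X // IsBSetHom SY S.toBSetStruct f} where
  toBSetStruct := BSetStruct.hom SY S.toBSetStruct
  pop P hP hinf f := ⟨fun y => S.pop P hP hinf fun b => (f b).1 y,
    S.isBSetHom_of_eqv hP (fun b => (f b).2)
      fun b y => S.act_pop P hP hinf (fun b => (f b).1 y) b⟩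
  pop_const P hP hinf _ := Subtype.ext (funext fun _ => S.pop_const P hP hinf _)
  pop_act P hP hinf f g := Subtype.ext (funext fun y =>
    S.pop_act P hP hinf (fun b => (f b).1 y) (fun b => (g b).1 y))
  act_pop P hP hinf f b := Subtype.ext (funext fun y =>
    S.act_pop P hP hinf (fun b => (f b).1 y) b)

end BJSetStruct


/-- The variety of `B_𝒥`-sets is cartesian closed: the `B`-set `Z^Y` of
`B`-set homomorphisms `Y → Z` with pointwise operations is a `B_𝒥`-set (for
each `P ∈ 𝒥` and each family of homomorphisms `(f_b)_{b ∈ P}` there is a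
unique homomorphism `g` with `g(y) ≡_b f_b(y)` for all `b, y`), and with
evaluation and transposition it is an exponential. -/
theorem bjset_cartesian_closed (B Y Z : Type) [BooleanAlgebra B]
    (nondeg : (⊥ : B) ≠ ⊤) (𝒥 : ZeroDimTopology B)
    (SY : BJSetStruct B 𝒥 Y) (SZ : BJSetStruct B 𝒥 Z) :
    ∃ SE : BJSetStruct B 𝒥
        {f : Y → Z // IsBSetHom SY.toBSetStruct SZ.toBSetStruct f},
      -- underlying `B`-set structure is pointwise
      (∀ (b : B) (f g : {f : Y → Z // IsBSetHom SY.toBSetStruct SZ.toBSetStruct f})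
          (y : Y),
        (SE.toBSetStruct.act b f g).1 y = SZ.toBSetStruct.act b (f.1 y) (g.1 y)) ∧
      -- glueing of homomorphisms along partitions in `𝒥`
      (∀ P ∈ 𝒥.J,
        ∀ f : P → {f : Y → Z // IsBSetHom SY.toBSetStruct SZ.toBSetStruct f},
        ∃! g : {f : Y → Z // IsBSetHom SY.toBSetStruct SZ.toBSetStruct f},
          ∀ (b : P) (y : Y), SZ.toBSetStruct.eqv b.1 (g.1 y) ((f b).1 y)) ∧
      -- evaluation is a homomorphism
      IsBSetHom (prodBSet SE.toBSetStruct SY.toBSetStruct) SZ.toBSetStruct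
        (fun p => p.1.1 p.2) ∧
      -- unique transposition
      (∀ (X : Type) (SX : BJSetStruct B 𝒥 X) (f : X × Y → Z),
        IsBSetHom (prodBSet SX.toBSetStruct SY.toBSetStruct) SZ.toBSetStruct f →
        ∃! g : X → {f : Y → Z // IsBSetHom SY.toBSetStruct SZ.toBSetStruct f},
          IsBSetHom SX.toBSetStruct SE.toBSetStruct g ∧
          ∀ (x : X) (y : Y), (g x).1 y = f (x, y)) := by
  refine ⟨SZ.hom SY.toBSetStruct, fun _ _ _ _ => rfl, fun P hP f => ?_, ?_, ?_⟩
  · choose g hg using fun y => SZ.exists_eqv nondeg hP fun b => (f b).1 y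
    refine ⟨⟨g, SZ.isBSetHom_of_eqv hP (fun b => (f b).2) fun b y => hg y b⟩,
      fun b y => hg y b, fun g' hg' => Subtype.ext (funext fun y => ?_)⟩
    exact SZ.eq_of_forall_eqv hP fun b hb => (hg' ⟨b, hb⟩ y).trans (hg y ⟨b, hb⟩).symm
  · rintro b ⟨f, y⟩ ⟨f', y'⟩
    change SZ.act b (f.1 (SY.act b y y')) (f'.1 (SY.act b y y')) = SZ.act b (f.1 y) (f'.1 y')
    rw [f.2, f'.2, SZ.act_absorb_left, SZ.act_absorb_right]
  · intro X SX f hf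
    refine ⟨fun x => ⟨fun y => f (x, y), fun b y y' => ?_⟩,
      ⟨fun b x x' => Subtype.ext (funext fun y => ?_), fun _ _ => rfl⟩,
      fun g hg => funext fun x => Subtype.ext (funext fun y => hg.2 x y)⟩
    · simpa [prodBSet, SX.act_refl] using hf b (x, y) (x, y')
    · change f (SX.act b x x', y) = SZ.act b (f (x, y)) (f (x', y))
      simpa [prodBSet, SY.act_refl] using hf b (x, y) (x', y)
end

section
/- Let 𝕋 be a non-degenerate hyperaffine algebraic theory and B = T(2) its Boolean algebra. Say an operation h ∈ T(I) realises a partition P of B if P = {h^{(i)} : i ∈ I}∖{0}. Then the set 𝒥 of all partitions of B realised by operations of 𝕋 is a zero-dimensional topology on B. Moreover, if 𝕋 is finitary, then 𝒥 is exactly the set of finite partitions of B. -/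
/-- An (infinitary) algebraic theory. -/
structure AlgTheory where
  T : Type → Type
  pr : ∀ {I : Type}, I → T I
  subst : ∀ {I J : Type}, T I → (I → T J) → T J
  subst_pr : ∀ {I : Type} (t : T I), subst t (fun i => pr i) = t
  pr_subst : ∀ {I J : Type} (i : I) (u : I → T J), subst (pr i) u = u i
  subst_assoc : ∀ {I J K : Type} (t : T I) (u : I → T J) (v : J → T K),
      subst (subst t u) v = subst t (fun i => subst (u i) v)

def AlgTheory.IsAffine (𝕋 : AlgTheory) {I : Type} (t : 𝕋.T I) : Prop :=
  𝕋.subst t (fun _ => 𝕋.pr PUnit.unit) = 𝕋.pr PUnit.unit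

def AlgTheory.IsHyperaffine (𝕋 : AlgTheory) {I : Type} (t : 𝕋.T I) : Prop :=
  𝕋.IsAffine t ∧
  𝕋.subst t (fun i => 𝕋.subst t (fun j => 𝕋.pr (i, j))) =
    𝕋.subst t (fun i => 𝕋.pr (i, i))

/-- `𝕋` is finitary: every operation factors through a finite arity. -/
def AlgTheory.Finitary (𝕋 : AlgTheory) : Prop :=
  ∀ (I : Type) (t : 𝕋.T I), ∃ (n : ℕ) (f : Fin n → I) (u : 𝕋.T (Fin n)),
    t = 𝕋.subst u (fun k => 𝕋.pr (f k))

def AlgTheory.sub2 (𝕋 : AlgTheory) (b c d : 𝕋.T Bool) : 𝕋.T Bool :=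
  𝕋.subst b (fun i => if i then c else d)

-- The binary reduct `t^{(U)} ∈ T 2` of `t ∈ T I` along `U ⊆ I`.
open Classical in
noncomputable def AlgTheory.reduct (𝕋 : AlgTheory) {I : Type} (t : 𝕋.T I) (U : Set I) :
    𝕋.T Bool :=
  𝕋.subst t (fun i => if i ∈ U then 𝕋.pr true else 𝕋.pr false)

/-- `J` is a zero-dimensional topology on the Boolean algebra `B`. -/
def IsZeroDimTopology {B : Type} [BooleanAlgebra B] (J : Set (Set B)) : Prop :=
  (∀ P ∈ J, IsPartitionOf P ⊤) ∧
  (∀ P : Set B, IsPartitionOf P ⊤ → P.Finite → P ∈ J) ∧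
  (∀ P ∈ J, ∀ Q : B → Set B, (∀ b ∈ P, Q b ∈ J) →
    ({d : B | ∃ b ∈ P, ∃ c ∈ Q b, d = b ⊓ c} \ {⊥}) ∈ J) ∧
  (∀ P, ∀ hP : P ∈ J, ∀ (I : Type) (α : P → I), Function.Surjective α →
    (∀ i : I, ∃ s : B, IsLUB (Subtype.val '' (α ⁻¹' {i})) s) ∧
    {s : B | ∃ i : I, IsLUB (Subtype.val '' (α ⁻¹' {i})) s} ∈ J)

/-- The operation `h ∈ T I` realises the partition `P` of `B = T 2` when
`P = {h^{(i)} : i ∈ I} \ {0}`. -/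
def Realises (𝕋 : AlgTheory) [BooleanAlgebra (𝕋.T Bool)] {I : Type}
    (h : 𝕋.T I) (P : Set (𝕋.T Bool)) : Prop :=
  P = Set.range (fun i => 𝕋.reduct h {i}) \ {⊥}

namespace AlgTheory

variable {𝕋 : AlgTheory}

theorem subst_const {I J : Type} {t : 𝕋.T I} (ht : 𝕋.IsAffine t) (x : 𝕋.T J) :
    𝕋.subst t (fun _ => x) = x := by
  have h := congrArg (fun s => 𝕋.subst s (fun _ => x)) ht
  simpa only [𝕋.subst_assoc, 𝕋.pr_subst] using h

theorem subst_diag {I J : Type} {t : 𝕋.T I} (ht : 𝕋.IsHyperaffine t) (f : I → I → 𝕋.T J) :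
    𝕋.subst t (fun i => 𝕋.subst t (fun j => f i j)) = 𝕋.subst t (fun i => f i i) := by
  have h := congrArg (fun s => 𝕋.subst s (fun p => f p.1 p.2)) ht.2
  simpa only [𝕋.subst_assoc, 𝕋.pr_subst] using h

theorem sub2_pr (b : 𝕋.T Bool) : 𝕋.sub2 b (𝕋.pr true) (𝕋.pr false) = b := by
  rw [sub2]
  convert 𝕋.subst_pr b using 2
  funext i
  cases i <;> rfl

theorem reduct_subst {I J : Type} (t : 𝕋.T I) (u : I → 𝕋.T J) (U : Set J) :
    𝕋.reduct (𝕋.subst t u) U = 𝕋.subst t (fun i => 𝕋.reduct (u i) U) :=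
  𝕋.subst_assoc ..

theorem reduct_sub2 {J : Type} (b : 𝕋.T Bool) (x y : 𝕋.T J) (U : Set J) :
    𝕋.reduct (𝕋.subst b (fun i => if i then x else y)) U =
      𝕋.sub2 b (𝕋.reduct x U) (𝕋.reduct y U) := by
  rw [reduct_subst, sub2]
  congr 1
  funext i
  cases i <;> rfl

open Classical in
theorem reduct_pr {I : Type} (i : I) (U : Set I) :
    𝕋.reduct (𝕋.pr i) U = if i ∈ U then 𝕋.pr true else 𝕋.pr false :=
  𝕋.pr_subst ..

theorem reduct_map {I J : Type} (t : 𝕋.T I) (f : I → J) (U : Set J) :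
    𝕋.reduct (𝕋.subst t (fun i => 𝕋.pr (f i))) U = 𝕋.reduct t (f ⁻¹' U) := by
  simp only [reduct_subst, reduct_pr]
  rfl

/-- The bounds, meets and complements of `𝕋.T Bool` are the ones determined by the operations of `𝕋`. -/
structure IsBooleanReduct (𝕋 : AlgTheory) [BooleanAlgebra (𝕋.T Bool)] : Prop where
  top_eq : (⊤ : 𝕋.T Bool) = 𝕋.pr true
  bot_eq : (⊥ : 𝕋.T Bool) = 𝕋.pr false
  inf_eq : ∀ b c : 𝕋.T Bool,
    b ⊓ c = 𝕋.sub2 b (𝕋.sub2 c (𝕋.pr true) (𝕋.pr false)) (𝕋.pr false)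
  compl_eq : ∀ b : 𝕋.T Bool, bᶜ = 𝕋.sub2 b (𝕋.pr false) (𝕋.pr true)

variable [BooleanAlgebra (𝕋.T Bool)]

open Classical in
theorem reduct_eq (hB : 𝕋.IsBooleanReduct) {I : Type} (t : 𝕋.T I) (U : Set I) :
    𝕋.reduct t U = 𝕋.subst t (fun i => if i ∈ U then ⊤ else ⊥) := by
  rw [hB.top_eq, hB.bot_eq, reduct]

theorem subst_inf (hB : 𝕋.IsBooleanReduct) {I : Type} (t : 𝕋.T I) (f : I → 𝕋.T Bool)
    (c : 𝕋.T Bool) : 𝕋.subst t f ⊓ c = 𝕋.subst t (fun i => f i ⊓ c) := by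
  simp only [hB.inf_eq]
  exact 𝕋.subst_assoc ..

theorem subst_inf_subst (hB : 𝕋.IsBooleanReduct) {I : Type} {t : 𝕋.T I}
    (ht : 𝕋.IsHyperaffine t) (f g : I → 𝕋.T Bool) :
    𝕋.subst t f ⊓ 𝕋.subst t g = 𝕋.subst t (fun i => f i ⊓ g i) := by
  rw [subst_inf hB]
  simp only [inf_comm (f _), subst_inf hB]
  rw [subst_diag ht (fun i j => g j ⊓ f i)]

open Classical in
theorem reduct_inf (hB : 𝕋.IsBooleanReduct) {I : Type} (t : 𝕋.T I) (U : Set I)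
    (c : 𝕋.T Bool) :
    𝕋.reduct t U ⊓ c = 𝕋.subst t (fun i => if i ∈ U then c else ⊥) := by
  rw [reduct_eq hB, subst_inf hB]
  congr 1
  funext i
  split_ifs <;> simp

theorem reduct_inf_reduct (hB : 𝕋.IsBooleanReduct) {I : Type} {t : 𝕋.T I}
    (ht : 𝕋.IsHyperaffine t) (U V : Set I) :
    𝕋.reduct t U ⊓ 𝕋.reduct t V = 𝕋.reduct t (U ∩ V) := by
  classical
  simp only [reduct_eq hB, subst_inf_subst hB ht]
  congr 1
  funext i
  by_cases hU : i ∈ U <;> by_cases hV : i ∈ V <;> simp [hU, hV]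

theorem reduct_empty (hB : 𝕋.IsBooleanReduct) {I : Type} {t : 𝕋.T I} (ht : 𝕋.IsAffine t) :
    𝕋.reduct t ∅ = ⊥ := by
  simp [reduct_eq hB, subst_const ht]

theorem reduct_univ (hB : 𝕋.IsBooleanReduct) {I : Type} {t : 𝕋.T I} (ht : 𝕋.IsAffine t) :
    𝕋.reduct t Set.univ = ⊤ := by
  simp [reduct_eq hB, subst_const ht]

theorem reduct_inf_eq_bot (hB : 𝕋.IsBooleanReduct) {I : Type} {t : 𝕋.T I}
    (ht : 𝕋.IsHyperaffine t) {i j : I} (hij : i ≠ j) :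
    𝕋.reduct t {i} ⊓ 𝕋.reduct t {j} = ⊥ := by
  rw [reduct_inf_reduct hB ht, Set.singleton_inter_eq_empty.2 (by simpa using hij),
    reduct_empty hB ht.1]

/-- The binary reduct along `U` is the supremum of the binary reducts at the points of `U`. -/
theorem isLUB_reduct (hB : 𝕋.IsBooleanReduct) {I : Type} {t : 𝕋.T I}
    (ht : 𝕋.IsHyperaffine t) (U : Set I) :
    IsLUB ((fun i => 𝕋.reduct t {i}) '' U) (𝕋.reduct t U) := by
  classical
  have key (c : 𝕋.T Bool) :
      𝕋.subst t (fun i => if i ∈ U then 𝕋.reduct t {i} ⊓ c else ⊥) = 𝕋.reduct t U ⊓ c := by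
    have h (i : I) : (if i ∈ U then 𝕋.reduct t {i} ⊓ c else ⊥) =
        𝕋.subst t (fun j => if i ∈ U ∧ j = i then c else ⊥) := by
      split_ifs with hi
      · simp [reduct_inf hB, hi]
      · simp [hi, subst_const ht.1]
    simp only [h]
    rw [subst_diag ht (fun i j => if i ∈ U ∧ j = i then c else ⊥), reduct_inf hB]
    simp
  constructor
  · rintro _ ⟨i, hi, rfl⟩
    rw [← inf_eq_left, reduct_inf_reduct hB ht, Set.inter_eq_left.2 (by simpa using hi)]
  · intro c hc
    rw [← inf_eq_left, ← key c, ← inf_top_eq (𝕋.reduct t U), ← key ⊤]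
    congr 1
    funext i
    split_ifs with hi
    · rw [inf_top_eq, inf_eq_left]
      exact hc ⟨i, hi, rfl⟩
    · rfl

theorem sub2_bot_left (hB : 𝕋.IsBooleanReduct) (b c : 𝕋.T Bool) :
    𝕋.sub2 b ⊥ c = bᶜ ⊓ c := by
  rw [hB.compl_eq, hB.inf_eq, hB.bot_eq, sub2_pr, sub2, sub2, sub2, 𝕋.subst_assoc]
  congr 1
  funext i
  cases i <;> simp [𝕋.pr_subst]

/-- The operation that selects the first element of a list of binary operations that holds. -/
def select (𝕋 : AlgTheory) : List (𝕋.T Bool) → 𝕋.T (Option (𝕋.T Bool))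
  | [] => 𝕋.pr none
  | b :: l => 𝕋.subst b (fun i => if i then 𝕋.pr (some b) else select 𝕋 l)

theorem reduct_select_of_notMem (hB : 𝕋.IsBooleanReduct) {l : List (𝕋.T Bool)} {c : 𝕋.T Bool}
    (hc : c ∉ l) : 𝕋.reduct (𝕋.select l) {some c} = ⊥ := by
  induction l with
  | nil => simp [select, reduct_pr, hB.bot_eq]
  | cons b l ih =>
    rw [List.mem_cons, not_or] at hc
    rw [select, reduct_sub2, ih hc.2, reduct_pr,
      if_neg (by simpa using Ne.symm hc.1), ← hB.bot_eq, sub2_bot_left hB, inf_bot_eq]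

theorem reduct_select_of_mem (hB : 𝕋.IsBooleanReduct) {l : List (𝕋.T Bool)} {c : 𝕋.T Bool}
    (hl : l.Pairwise (fun b d => b ≠ d ∧ b ⊓ d = ⊥)) (hc : c ∈ l) :
    𝕋.reduct (𝕋.select l) {some c} = c := by
  induction l with
  | nil => simp at hc
  | cons b l ih =>
    rw [List.pairwise_cons] at hl
    rw [select, reduct_sub2, reduct_pr]
    by_cases h : c = b
    · subst h
      rw [reduct_select_of_notMem hB (fun hm => (hl.1 _ hm).1 rfl),
        if_pos (Set.mem_singleton _), hB.bot_eq, sub2_pr]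
    · have hm : c ∈ l := (List.mem_cons.1 hc).resolve_left h
      rw [if_neg (by simpa using Ne.symm h), ih hl.2 hm, ← hB.bot_eq, sub2_bot_left hB,
        inf_eq_right]
      exact (disjoint_iff.2 (hl.1 c hm).2).le_compl_left

end AlgTheory

section Realises

open AlgTheory

variable {𝕋 : AlgTheory} [BooleanAlgebra (𝕋.T Bool)]

theorem Realises.isPartitionOf (hB : 𝕋.IsBooleanReduct) {I : Type} {h : 𝕋.T I}
    (hh : 𝕋.IsHyperaffine h) {P : Set (𝕋.T Bool)} (hP : Realises 𝕋 h P) :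
    IsPartitionOf P ⊤ := by
  rw [Realises] at hP
  subst hP
  refine ⟨fun c hc => hc.2, ?_, ?_⟩
  · rintro _ ⟨⟨i, rfl⟩, -⟩ _ ⟨⟨j, rfl⟩, -⟩ hij
    exact reduct_inf_eq_bot hB hh (fun e => hij (by rw [e]))
  · have := isLUB_reduct hB hh Set.univ
    rw [reduct_univ hB hh.1, Set.image_univ] at this
    refine ⟨fun c hc => le_top, fun c hc => this.2 fun d hd => ?_⟩
    by_cases h0 : d = ⊥
    · exact h0 ▸ bot_le
    · exact hc ⟨hd, h0⟩

theorem IsPartitionOf.exists_realises (hB : 𝕋.IsBooleanReduct)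
    (hyp : ∀ (I : Type) (t : 𝕋.T I), 𝕋.IsHyperaffine t) {P : Set (𝕋.T Bool)}
    (hP : IsPartitionOf P ⊤) (hfin : P.Finite) :
    ∃ (I : Type) (h : 𝕋.T I), Realises 𝕋 h P := by
  set l := hfin.toFinset.toList with hl
  have mem_l (c : 𝕋.T Bool) : c ∈ l ↔ c ∈ P := by simp [hl]
  have hpair : l.Pairwise (fun b d => b ≠ d ∧ b ⊓ d = ⊥) :=
    hfin.toFinset.nodup_toList.imp_of_mem (fun ha hb hab =>
      ⟨hab, hP.2.1 _ ((mem_l _).1 ha) _ ((mem_l _).1 hb) hab⟩)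
  have hsome {c : 𝕋.T Bool} (hc : c ∈ P) : 𝕋.reduct (𝕋.select l) {some c} = c :=
    reduct_select_of_mem hB hpair ((mem_l c).2 hc)
  have hnone : 𝕋.reduct (𝕋.select l) {none} = ⊥ := by
    rw [← compl_eq_top, ← top_le_iff]
    refine hP.2.2.2 fun c hc => ?_
    have h := reduct_inf_eq_bot hB (hyp _ (𝕋.select l)) (Option.some_ne_none c)
    rw [hsome hc] at h
    exact (disjoint_iff.2 h).le_compl_right
  refine ⟨_, 𝕋.select l, Set.ext fun c => ⟨fun hc => ⟨⟨some c, hsome hc⟩, hP.1 c hc⟩, ?_⟩⟩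
  rintro ⟨⟨_ | b, rfl⟩, hb⟩
  · exact absurd hnone hb
  · by_cases hbP : b ∈ P
    · simpa only [hsome hbP] using hbP
    · exact absurd (reduct_select_of_notMem hB (fun hm => hbP ((mem_l b).1 hm))) hb

theorem Realises.exists_realises_inf (hB : 𝕋.IsBooleanReduct)
    (hyp : ∀ (I : Type) (t : 𝕋.T I), 𝕋.IsHyperaffine t) {I : Type} {h : 𝕋.T I}
    {P : Set (𝕋.T Bool)} (hP : Realises 𝕋 h P) {Q : 𝕋.T Bool → Set (𝕋.T Bool)}
    (hQ : ∀ b ∈ P, ∃ (J : Type) (k : 𝕋.T J), Realises 𝕋 k (Q b)) :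
    ∃ (J : Type) (k : 𝕋.T J),
      Realises 𝕋 k ({d | ∃ b ∈ P, ∃ c ∈ Q b, d = b ⊓ c} \ {⊥}) := by
  have hQ' (b : 𝕋.T Bool) : ∃ (J : Type) (k : 𝕋.T J), b ∈ P → Realises 𝕋 k (Q b) := by
    by_cases hb : b ∈ P
    · obtain ⟨J, k, hk⟩ := hQ b hb
      exact ⟨J, k, fun _ => hk⟩
    · exact ⟨PUnit, 𝕋.pr PUnit.unit, fun h => absurd h hb⟩
  choose J k hk using hQ'
  let r (i : I) : 𝕋.T Bool := 𝕋.reduct h {i}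
  let u : 𝕋.T (Σ i, J (r i)) := 𝕋.subst h (fun i => 𝕋.subst (k (r i)) (fun j => 𝕋.pr ⟨i, j⟩))
  have hu (i : I) (j : J (r i)) : 𝕋.reduct u {⟨i, j⟩} = r i ⊓ 𝕋.reduct (k (r i)) {j} := by
    classical
    simp only [u]
    rw [reduct_subst]
    simp only [r]
    rw [reduct_inf hB]
    congr 1
    funext i'
    rw [reduct_map]
    split_ifs with hi
    · obtain rfl : i' = i := hi
      refine congrArg (𝕋.reduct (k (r i'))) ?_
      ext j'
      simp
    · refine (congrArg (𝕋.reduct (k (r i'))) ?_).trans (reduct_empty hB (hyp _ _).1)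
      ext j'
      simp only [Set.mem_preimage, Set.mem_singleton_iff, Set.mem_empty_iff_false, iff_false]
      exact fun e => hi (congrArg Sigma.fst e)
  have hP' : P = Set.range r \ {⊥} := hP
  refine ⟨_, u, ?_⟩
  ext d
  constructor
  · rintro ⟨⟨b, hb, c, hc, rfl⟩, hd⟩
    refine ⟨?_, hd⟩
    obtain ⟨i, rfl⟩ := (hP' ▸ hb).1
    rw [hk _ hb] at hc
    obtain ⟨j, rfl⟩ := hc.1
    exact ⟨⟨i, j⟩, hu i j⟩
  · rintro ⟨⟨⟨i, j⟩, rfl⟩, hd⟩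
    refine ⟨?_, hd⟩
    simp only [hu, Set.mem_singleton_iff] at hd ⊢
    have hi : r i ∈ P := by
      rw [hP']
      exact ⟨⟨i, rfl⟩, fun e => hd (eq_bot_mono inf_le_left e)⟩
    refine ⟨r i, hi, 𝕋.reduct (k (r i)) {j}, ?_, rfl⟩
    rw [hk _ hi]
    exact ⟨⟨j, rfl⟩, fun e => hd (eq_bot_mono inf_le_right e)⟩

theorem Realises.exists_realises_fibers (hB : 𝕋.IsBooleanReduct)
    (hyp : ∀ (I : Type) (t : 𝕋.T I), 𝕋.IsHyperaffine t) {I : Type} {h : 𝕋.T I}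
    {P : Set (𝕋.T Bool)} (hP : Realises 𝕋 h P) {K : Type} {α : P → K}
    (hα : Function.Surjective α) :
    (∀ k : K, ∃ s : 𝕋.T Bool, IsLUB (Subtype.val '' (α ⁻¹' {k})) s) ∧
      ∃ (J : Type) (u : 𝕋.T J),
        Realises 𝕋 u {s | ∃ k : K, IsLUB (Subtype.val '' (α ⁻¹' {k})) s} := by
  classical
  let r (i : I) : 𝕋.T Bool := 𝕋.reduct h {i}
  have hP' : P = Set.range r \ {⊥} := hP
  let f (i : I) : Option K := if hi : r i ∈ P then some (α ⟨r i, hi⟩) else none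
  have hf (k : K) : Subtype.val '' (α ⁻¹' {k}) = r '' (f ⁻¹' {some k}) := by
    ext b
    constructor
    · rintro ⟨⟨b, hb⟩, hbk, rfl⟩
      obtain ⟨i, rfl⟩ := (hP' ▸ hb).1
      refine ⟨i, ?_, rfl⟩
      have : α ⟨r i, hb⟩ = k := hbk
      simp [f, hb, this]
    · rintro ⟨i, hi, rfl⟩
      by_cases hiP : r i ∈ P
      · refine ⟨⟨r i, hiP⟩, ?_, rfl⟩
        simpa [f, hiP] using hi
      · simp [f, hiP] at hi
  have hlub (k : K) : IsLUB (Subtype.val '' (α ⁻¹' {k})) (𝕋.reduct h (f ⁻¹' {some k})) := by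
    rw [hf]
    exact isLUB_reduct hB (hyp _ _) _
  refine ⟨fun k => ⟨_, hlub k⟩, Option K, 𝕋.subst h (fun i => 𝕋.pr (f i)), ?_⟩
  ext s
  simp only [reduct_map]
  constructor
  · rintro ⟨k, hk⟩
    refine ⟨⟨some k, (hlub k).unique hk⟩, fun hs => ?_⟩
    obtain ⟨p, hp⟩ := hα k
    have hp0 : (p : 𝕋.T Bool) ≠ ⊥ := (hP' ▸ p.2 : (p : 𝕋.T Bool) ∈ Set.range r \ {⊥}).2
    have hps : (p : 𝕋.T Bool) ≤ s := hk.1 ⟨p, hp, rfl⟩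
    rw [Set.mem_singleton_iff.1 hs] at hps
    exact hp0 (le_bot_iff.1 hps)
  · rintro ⟨⟨_ | k, rfl⟩, hs⟩
    · refine absurd (le_bot_iff.1 ((isLUB_reduct hB (hyp _ h) (f ⁻¹' {none})).2 ?_)) hs
      rintro _ ⟨i, hi, rfl⟩
      by_contra h0
      have hiP : r i ∈ P := by
        rw [hP']
        exact ⟨⟨i, rfl⟩, fun e => h0 (le_of_eq e)⟩
      simp [f, hiP] at hi
    · exact ⟨k, hlub k⟩

theorem Realises.finite (hB : 𝕋.IsBooleanReduct)
    (hyp : ∀ (I : Type) (t : 𝕋.T I), 𝕋.IsHyperaffine t) (hfin : 𝕋.Finitary) {I : Type}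
    {h : 𝕋.T I} {P : Set (𝕋.T Bool)} (hP : Realises 𝕋 h P) : P.Finite := by
  obtain ⟨n, f, u, rfl⟩ := hfin I h
  rw [Realises] at hP
  refine ((Set.finite_range f).image fun i =>
    𝕋.reduct (𝕋.subst u (fun k => 𝕋.pr (f k))) {i}).subset ?_
  rw [hP]
  rintro _ ⟨⟨i, rfl⟩, hi⟩
  by_cases hif : i ∈ Set.range f
  · exact ⟨i, hif, rfl⟩
  · refine absurd ?_ hi
    simp only [reduct_map, Set.preimage_singleton_eq_empty.2 hif]
    exact reduct_empty hB (hyp _ u).1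

end Realises


/-- The realised partitions of a non-degenerate hyperaffine theory form a
zero-dimensional topology on `B = T 2`; if `𝕋` is finitary, it consists of
exactly the finite partitions. -/
theorem realised_partitions_zeroDimTopology (𝕋 : AlgTheory)
    (nondeg : (𝕋.pr true : 𝕋.T Bool) ≠ 𝕋.pr false)
    (hyp : ∀ (I : Type) (t : 𝕋.T I), 𝕋.IsHyperaffine t)
    [BooleanAlgebra (𝕋.T Bool)]
    (htop : (⊤ : 𝕋.T Bool) = 𝕋.pr true)
    (hbot : (⊥ : 𝕋.T Bool) = 𝕋.pr false)
    (hinf : ∀ b c : 𝕋.T Bool,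
      b ⊓ c = 𝕋.sub2 b (𝕋.sub2 c (𝕋.pr true) (𝕋.pr false)) (𝕋.pr false))
    (hsup : ∀ b c : 𝕋.T Bool,
      b ⊔ c = 𝕋.sub2 b (𝕋.pr true) (𝕋.sub2 c (𝕋.pr true) (𝕋.pr false)))
    (hcompl : ∀ b : 𝕋.T Bool, bᶜ = 𝕋.sub2 b (𝕋.pr false) (𝕋.pr true)) :
    IsZeroDimTopology
      {P : Set (𝕋.T Bool) | ∃ (I : Type) (h : 𝕋.T I), Realises 𝕋 h P} ∧
    (𝕋.Finitary →
      {P : Set (𝕋.T Bool) | ∃ (I : Type) (h : 𝕋.T I), Realises 𝕋 h P} =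
        {P : Set (𝕋.T Bool) | IsPartitionOf P ⊤ ∧ P.Finite}) := by
  have hB : 𝕋.IsBooleanReduct := ⟨htop, hbot, hinf, hcompl⟩
  refine ⟨⟨?_, fun P hP hfin => hP.exists_realises hB hyp hfin, ?_, ?_⟩, fun hfin => ?_⟩
  · rintro P ⟨I, h, hP⟩
    exact hP.isPartitionOf hB (hyp I h)
  · rintro P ⟨I, h, hP⟩ Q hQ
    exact hP.exists_realises_inf hB hyp hQ
  · rintro P ⟨I, h, hP⟩ K α hα
    exact hP.exists_realises_fibers hB hyp hα
  · ext P
    constructor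
    · rintro ⟨I, h, hP⟩
      exact ⟨hP.isPartitionOf hB (hyp I h), hP.finite hB hyp hfin⟩
    · rintro ⟨hP, hPfin⟩
      exact hP.exists_realises hB hyp hPfin
end
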